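/- arXiv:2109.04558 — 2 statements merged into one kernel-verified Lean document; each statement's English description precedes it below -/
import Mathlib

section
/- Let 1 ≤ k ≤ n, and let P be an n×n complex matrix with P² = P = P*, rank(P) = k, such that every k×k minor of P is a positive real number. Let 1 ≤ l ≤ k and let I, J be subsets of {1,…,n} with |I| = |J| = l satisfying the evenness condition: for all integers a < b with a ∉ I∪J and b ∉ I∪J, the number #{c ∈ I : a < c < b} + #{c ∈ J : a < c < b} is even. Then: (i) if |I ∩ J| ≥ k + l − n, the minor Δ_{I,J}(P) is a positive real number; (ii) if |I ∩ J| < k + l − n, then Δ_{I,J}(P) = 0. -/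
open Matrix Finset

/-- The minor of a square matrix `g` on row set `I` and column set `J`
(rows and columns listed in increasing order); defined to be `0` if `I` and `J`
have different cardinalities. -/
noncomputable def minorOn {R : Type} [CommRing R] {n : ℕ} (g : Matrix (Fin n) (Fin n) R)
    (I J : Finset (Fin n)) : R :=
  if h : J.card = I.card then
    Matrix.det (Matrix.of fun a b : Fin I.card =>
      g ((I.orderIsoOfFin rfl a : Fin n)) ((J.orderIsoOfFin h b : Fin n)))
  else 0

/-- The left-justified minor `Δ_I(g)`: the minor on rows `I` and the first `|I|` columns. -/
noncomputable def leftMinor {R : Type} [CommRing R] {n : ℕ} (g : Matrix (Fin n) (Fin n) R)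
    (I : Finset (Fin n)) : R :=
  minorOn g I (Finset.univ.filter fun j : Fin n => (j : ℕ) < I.card)

/-- A complex number is a positive real. -/
def IsPosReal (z : ℂ) : Prop := 0 < z.re ∧ z.im = 0

/-- A complex number is a nonnegative real. -/
def IsNonnegReal (z : ℂ) : Prop := 0 ≤ z.re ∧ z.im = 0

/-- The diagonal sign matrix `δ_n = diag(1, −1, 1, …, (−1)^{n−1})`. -/
noncomputable def deltaMat (n : ℕ) : Matrix (Fin n) (Fin n) ℂ :=
  Matrix.diagonal fun i : Fin n => (-1 : ℂ) ^ (i : ℕ)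

/-- The totally positive part `U_n^{>0}` of the unitary group: unitary matrices all of
whose left-justified minors are positive real numbers. -/
def UnitaryTP (n : ℕ) : Set (Matrix (Fin n) (Fin n) ℂ) :=
  {g | g.conjTranspose * g = 1 ∧ ∀ I : Finset (Fin n), IsPosReal (leftMinor g I)}

lemma aux_cons_cycle {α : Type} {s : ℕ} (c : Fin (s + 1) → α) (j : Fin (s + 1)) :
    (Fin.cons (c j) (c ∘ j.succAbove) : Fin (s + 1) → α) = c ∘ (j.cycleRange.symm) := by
  funext x
  refine Fin.cases ?_ (fun y => ?_) x
  · simp [Fin.cycleRange_symm_zero]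
  · simp [Fin.cycleRange_symm_succ]

lemma aux_det_col {n s : ℕ} (P : Matrix (Fin n) (Fin n) ℂ)
    (r c : Fin (s + 1) → Fin n) (j : Fin (s + 1)) :
    (P.submatrix r (Fin.cons (c j) (c ∘ j.succAbove) : Fin (s + 1) → Fin n)).det
      = (-1) ^ (j : ℕ) * (P.submatrix r c).det := by
  rw [aux_cons_cycle]
  have h := det_permute' (j.cycleRange.symm) (P.submatrix r c)
  rw [submatrix_submatrix] at h
  simpa [Equiv.Perm.sign_symm, Fin.sign_cycleRange] using h

lemma aux_det_rowcol {n s : ℕ} (P : Matrix (Fin n) (Fin n) ℂ)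
    (r c : Fin (s + 1) → Fin n) (i j : Fin (s + 1)) :
    (P.submatrix (Fin.cons (r i) (r ∘ i.succAbove) : Fin (s + 1) → Fin n)
      (Fin.cons (c j) (c ∘ j.succAbove) : Fin (s + 1) → Fin n)).det
      = (-1) ^ ((i : ℕ) + (j : ℕ)) * (P.submatrix r c).det := by
  rw [aux_det_col, aux_cons_cycle]
  have h := det_permute (i.cycleRange.symm) (P.submatrix r c)
  rw [submatrix_submatrix] at h
  have h' : (P.submatrix (r ∘ (i.cycleRange.symm)) c).det
      = (-1) ^ (i : ℕ) * (P.submatrix r c).det := by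
    simpa [Equiv.Perm.sign_symm, Fin.sign_cycleRange] using h
  rw [h', pow_add]
  ring

lemma aux_lin {n s : ℕ} (P : Matrix (Fin n) (Fin n) ℂ) (hP2 : P * P = P)
    (r : Fin (s + 1) → Fin n) (c : Fin s → Fin n) (x : Fin n) :
    ∑ m, P m x * (P.submatrix r (Fin.cons m c : Fin (s + 1) → Fin n)).det
      = (P.submatrix r (Fin.cons x c : Fin (s + 1) → Fin n)).det := by
  simp only [det_succ_column_zero, mul_sum]
  rw [sum_comm]
  refine sum_congr rfl fun i _ => ?_
  have hm : ∀ m : Fin n, ((P.submatrix r (Fin.cons m c : Fin (s + 1) → Fin n)).submatrix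
      i.succAbove Fin.succ) = P.submatrix (r ∘ i.succAbove) c := by
    intro m; ext a b; simp
  simp only [hm]
  have hx : P (r i) x = ∑ m, P (r i) m * P m x := by
    conv_lhs => rw [← hP2]
    rfl
  simp only [submatrix_apply, Fin.cons_zero]
  rw [hx, mul_sum, sum_mul]
  refine sum_congr rfl fun m _ => ?_
  ring

lemma aux_border {n s : ℕ} (P : Matrix (Fin n) (Fin n) ℂ) (hP2 : P * P = P)
    (r c : Fin (s + 1) → Fin n) :
    ∑ m, (P.submatrix (Fin.cons m r : Fin (s + 2) → Fin n)
        (Fin.cons m c : Fin (s + 2) → Fin n)).det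
      = (P.trace - (s + 1)) * (P.submatrix r c).det := by
  have h1 : ∀ m, (P.submatrix (Fin.cons m r : Fin (s + 2) → Fin n)
        (Fin.cons m c : Fin (s + 2) → Fin n)).det
      = P m m * (P.submatrix r c).det + ∑ j : Fin (s + 1), (-1) ^ ((j : ℕ) + 1) *
        (P m (c j) * (P.submatrix r
          (Fin.cons m (c ∘ j.succAbove) : Fin (s + 1) → Fin n)).det) := by
    intro m
    rw [det_succ_row_zero, Fin.sum_univ_succ]
    congr 1
    · have : ((P.submatrix (Fin.cons m r : Fin (s + 2) → Fin n)
        (Fin.cons m c : Fin (s + 2) → Fin n)).submatrix Fin.succ (Fin.succAbove 0))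
          = P.submatrix r c := by
        ext a b; simp
      rw [this]; simp
    · refine sum_congr rfl fun j _ => ?_
      have : ((P.submatrix (Fin.cons m r : Fin (s + 2) → Fin n)
        (Fin.cons m c : Fin (s + 2) → Fin n)).submatrix Fin.succ (Fin.succAbove j.succ))
          = P.submatrix r (Fin.cons m (c ∘ j.succAbove) : Fin (s + 1) → Fin n) := by
        ext a b
        refine Fin.cases ?_ (fun y => ?_) b
        · simp
        · simp
      rw [this]
      simp [mul_assoc]
  simp only [h1]
  rw [sum_add_distrib, sum_comm]
  simp only [← mul_sum, aux_lin P hP2, aux_det_col]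
  rw [← sum_mul]
  have h2 : ∀ j : Fin (s + 1), (-1 : ℂ) ^ ((j : ℕ) + 1) *
      ((-1) ^ (j : ℕ) * (P.submatrix r c).det) = - (P.submatrix r c).det := by
    intro j
    have : (-1 : ℂ) ^ (j : ℕ) * (-1) ^ (j : ℕ) = 1 := by
      rw [← mul_pow]; simp
    rw [pow_succ]
    linear_combination (- (P.submatrix r c).det) * this
  simp only [h2]
  simp [Matrix.trace]
  ring

lemma aux_minorOn {n l : ℕ} (P : Matrix (Fin n) (Fin n) ℂ) (I J : Finset (Fin n))
    (hI : I.card = l) (hJ : J.card = l) :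
    minorOn P I J = (P.submatrix (I.orderEmbOfFin hI) (J.orderEmbOfFin hJ)).det := by
  subst hI
  unfold minorOn
  rw [dif_pos hJ]
  rfl

lemma aux_insert {n l : ℕ} (I : Finset (Fin n)) (hI : I.card = l) (m : Fin n) (hm : m ∉ I)
    (h : (insert m I).card = l + 1) :
    ∃ p : Fin (l + 1), (insert m I).orderEmbOfFin h p = m ∧
      (insert m I).orderEmbOfFin h ∘ p.succAbove = I.orderEmbOfFin hI ∧
      (p : ℕ) + (I.filter fun c => m < c).card = l := by
  obtain ⟨p, hp⟩ : ∃ p, (insert m I).orderEmbOfFin h p = m := by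
    have : m ∈ Set.range ((insert m I).orderEmbOfFin h) := by
      rw [range_orderEmbOfFin]; simp
    exact this
  refine ⟨p, hp, ?_, ?_⟩
  · apply orderEmbOfFin_unique
    · intro x
      have h1 := orderEmbOfFin_mem (insert m I) h (p.succAbove x)
      rcases mem_insert.1 h1 with h2 | h2
      · exfalso
        have h3 := ((insert m I).orderEmbOfFin h).injective (h2.trans hp.symm)
        exact Fin.succAbove_ne p x h3
      · exact h2
    · exact ((insert m I).orderEmbOfFin h).strictMono.comp (Fin.strictMono_succAbove p)
  · have himg : (I.filter fun c => m < c)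
        = (Finset.Ioi p).map ((insert m I).orderEmbOfFin h).toEmbedding := by
      ext x
      simp only [mem_filter, mem_map, Finset.mem_Ioi, RelEmbedding.coe_toEmbedding]
      constructor
      · rintro ⟨hx, hmx⟩
        have : x ∈ Set.range ((insert m I).orderEmbOfFin h) := by
          rw [range_orderEmbOfFin]; simp [hx]
        obtain ⟨q, rfl⟩ := this
        refine ⟨q, ?_, rfl⟩
        rw [← ((insert m I).orderEmbOfFin h).lt_iff_lt, hp]
        exact hmx
      · rintro ⟨q, hq, rfl⟩
        have h4 : m < (insert m I).orderEmbOfFin h q := by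
          conv_lhs => rw [← hp]
          exact ((insert m I).orderEmbOfFin h).strictMono hq
        refine ⟨?_, h4⟩
        exact mem_of_mem_insert_of_ne (orderEmbOfFin_mem (insert m I) h q) h4.ne'
    rw [himg, card_map, Fin.card_Ioi]
    omega

/-- Bordered minor in terms of the sorted minor. -/
lemma aux_term {n l : ℕ} (P : Matrix (Fin n) (Fin n) ℂ) (I J : Finset (Fin n))
    (hI : I.card = l) (hJ : J.card = l) (m : Fin n) (hmI : m ∉ I) (hmJ : m ∉ J)
    (he : Even ((I.filter fun c => m < c).card + (J.filter fun c => m < c).card)) :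
    (P.submatrix (Fin.cons m (I.orderEmbOfFin hI) : Fin (l + 1) → Fin n)
        (Fin.cons m (J.orderEmbOfFin hJ) : Fin (l + 1) → Fin n)).det
      = minorOn P (insert m I) (insert m J) := by
  have h1 : (insert m I).card = l + 1 := by rw [card_insert_of_notMem hmI, hI]
  have h2 : (insert m J).card = l + 1 := by rw [card_insert_of_notMem hmJ, hJ]
  obtain ⟨p, hp, hp', hpc⟩ := aux_insert I hI m hmI h1
  obtain ⟨q, hq, hq', hqc⟩ := aux_insert J hJ m hmJ h2
  have h3 := aux_det_rowcol P ((insert m I).orderEmbOfFin h1) ((insert m J).orderEmbOfFin h2) p q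
  rw [hp, hp', hq, hq'] at h3
  rw [h3, aux_minorOn P _ _ h1 h2]
  have : Even ((p : ℕ) + q) := by
    rw [Nat.even_iff] at he ⊢; omega
  rw [this.neg_one_pow, one_mul]

lemma aux_term_zero {n l : ℕ} (P : Matrix (Fin n) (Fin n) ℂ) (r c : Fin l → Fin n) (m : Fin n)
    (h : (∃ i, r i = m) ∨ (∃ i, c i = m)) :
    (P.submatrix (Fin.cons m r : Fin (l + 1) → Fin n)
        (Fin.cons m c : Fin (l + 1) → Fin n)).det = 0 := by
  rcases h with ⟨i, hi⟩ | ⟨i, hi⟩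
  · apply det_zero_of_row_eq (i := 0) (j := i.succ) (Fin.succ_ne_zero i).symm
    funext x; simp [hi]
  · apply det_zero_of_column_eq (i := 0) (j := i.succ) (Fin.succ_ne_zero i).symm
    intro x; simp [hi]

lemma aux_trace {n : ℕ} (P : Matrix (Fin n) (Fin n) ℂ) (hP2 : P * P = P) :
    P.trace = P.rank := by
  have h : IsIdempotentElem (Matrix.toLin' P) := by
    show Matrix.toLin' P * Matrix.toLin' P = _
    rw [Module.End.mul_eq_comp, ← Matrix.toLin'_mul, hP2]
  have h2 := (LinearMap.IsIdempotentElem.isProj_range _ h).trace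
  rw [Matrix.trace_toLin'_eq] at h2
  rw [h2]
  rfl

/-- The evenness condition on a pair of subsets. -/
def EvenPair {n : ℕ} (I J : Finset (Fin n)) : Prop :=
  ∀ a b : ℤ, a < b →
      (¬ ∃ c ∈ I ∪ J, ((c : ℕ) : ℤ) + 1 = a) →
      (¬ ∃ c ∈ I ∪ J, ((c : ℕ) : ℤ) + 1 = b) →
      Even ((I.filter fun c : Fin n => a < ((c : ℕ) : ℤ) + 1 ∧ ((c : ℕ) : ℤ) + 1 < b).card +
        (J.filter fun c : Fin n => a < ((c : ℕ) : ℤ) + 1 ∧ ((c : ℕ) : ℤ) + 1 < b).card)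

lemma EvenPair.insert_both {n : ℕ} {I J : Finset (Fin n)} (h : EvenPair I J) (m : Fin n)
    (hmI : m ∉ I) (hmJ : m ∉ J) : EvenPair (insert m I) (insert m J) := by
  intro a b hab ha hb
  have := h a b hab
    (fun ⟨c, hc, hca⟩ => ha ⟨c, by
      simp only [mem_union, mem_insert] at hc ⊢; tauto, hca⟩)
    (fun ⟨c, hc, hca⟩ => hb ⟨c, by
      simp only [mem_union, mem_insert] at hc ⊢; tauto, hca⟩)
  rw [filter_insert, filter_insert]
  split_ifs with hm
  · rw [card_insert_of_notMem (by simp [hmI]), card_insert_of_notMem (by simp [hmJ])]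
    rw [Nat.even_iff] at this ⊢; omega
  · exact this

lemma EvenPair.above {n : ℕ} {I J : Finset (Fin n)} (h : EvenPair I J) (m : Fin n)
    (hmI : m ∉ I) (hmJ : m ∉ J) :
    Even ((I.filter fun c => m < c).card + (J.filter fun c => m < c).card) := by
  have := h ((m : ℕ) + 1) (n + 1) (by have := m.2; omega)
    (by
      rintro ⟨c, hc, hcm⟩
      have : c = m := Fin.ext (by omega)
      subst this
      simp [hmI, hmJ] at hc)
    (by
      rintro ⟨c, hc, hcm⟩
      have := c.2
      omega)
  have hf : ∀ K : Finset (Fin n), (K.filter fun c => m < c) =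
      K.filter fun c : Fin n => (((m : ℕ) : ℤ) + 1) < ((c : ℕ) : ℤ) + 1 ∧
        ((c : ℕ) : ℤ) + 1 < (n : ℤ) + 1 := by
    intro K
    refine filter_congr fun c _ => ?_
    have := c.2
    rw [Fin.lt_def]
    constructor <;> intro h' <;> omega
  rw [hf I, hf J]
  exact this

lemma aux_rec {n k s : ℕ} (P : Matrix (Fin n) (Fin n) ℂ) (hP2 : P * P = P) (hr : P.rank = k)
    (I J : Finset (Fin n)) (hI : I.card = s + 1) (hJ : J.card = s + 1) (he : EvenPair I J) :
    ((k : ℂ) - (s + 1)) * minorOn P I J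
      = ∑ m ∈ (I ∪ J)ᶜ, minorOn P (insert m I) (insert m J) := by
  rw [aux_minorOn P I J hI hJ, ← hr, ← aux_trace P hP2, ← aux_border P hP2]
  rw [← sum_subset (subset_univ ((I ∪ J)ᶜ))]
  · refine sum_congr rfl fun m hm => ?_
    simp only [mem_compl, mem_union, not_or] at hm
    exact aux_term P I J hI hJ m hm.1 hm.2 (he.above m hm.1 hm.2)
  · intro m _ hm
    simp only [mem_compl, mem_union, not_not] at hm
    apply aux_term_zero
    rcases hm with hm | hm
    · left
      have : m ∈ Set.range (I.orderEmbOfFin hI) := by rw [range_orderEmbOfFin]; exact hm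
      exact this
    · right
      have : m ∈ Set.range (J.orderEmbOfFin hJ) := by rw [range_orderEmbOfFin]; exact hm
      exact this

lemma aux_main {n k : ℕ} (P : Matrix (Fin n) (Fin n) ℂ) (hP2 : P * P = P) (hr : P.rank = k)
    (hPpos : ∀ I J : Finset (Fin n), I.card = k → J.card = k → IsPosReal (minorOn P I J))
    (d : ℕ) : ∀ (l : ℕ), 1 ≤ l → l + d = k → ∀ I J : Finset (Fin n), I.card = l → J.card = l →
      EvenPair I J →
    (k + l ≤ (I ∩ J).card + n → IsPosReal (minorOn P I J)) ∧
    ((I ∩ J).card + n < k + l → minorOn P I J = 0) := by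
  induction d with
  | zero =>
    intro l hl1 hlk I J hI hJ he
    refine ⟨fun _ => hPpos I J (by omega) (by omega), fun h => ?_⟩
    exfalso
    have h1 := card_union_add_card_inter I J
    have h2 := card_le_univ (I ∪ J)
    rw [Fintype.card_fin] at h2
    omega
  | succ d ih =>
    intro l hl1 hlk I J hI hJ he
    obtain ⟨s, rfl⟩ : ∃ s, l = s + 1 := ⟨l - 1, by omega⟩
    have hrec := aux_rec P hP2 hr I J hI hJ he
    have hkd : (k : ℂ) - (s + 1) = ((d + 1 : ℕ) : ℂ) := by
      rw [← hlk]; push_cast; ring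
    rw [hkd] at hrec
    have hne : ((d + 1 : ℕ) : ℂ) ≠ 0 := Nat.cast_ne_zero.2 (by omega)
    have hterm : ∀ m ∈ (I ∪ J)ᶜ, (insert m I ∩ insert m J).card = (I ∩ J).card + 1 ∧
        (k + (s + 1 + 1) ≤ (insert m I ∩ insert m J).card + n →
          IsPosReal (minorOn P (insert m I) (insert m J))) ∧
        ((insert m I ∩ insert m J).card + n < k + (s + 1 + 1) →
          minorOn P (insert m I) (insert m J) = 0) := by
      intro m hm
      simp only [mem_compl, mem_union, not_or] at hm
      refine ⟨?_, ih (s + 1 + 1) (by omega) (by omega) _ _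
        (by rw [card_insert_of_notMem hm.1, hI]) (by rw [card_insert_of_notMem hm.2, hJ])
        (he.insert_both m hm.1 hm.2)⟩
      rw [← insert_inter_distrib, card_insert_of_notMem (by simp [hm.1])]
    constructor
    · intro h
      have hpos : ∀ m ∈ (I ∪ J)ᶜ, IsPosReal (minorOn P (insert m I) (insert m J)) := fun m hm =>
        (hterm m hm).2.1 (by rw [(hterm m hm).1]; omega)
      have hnon : ((I ∪ J)ᶜ).Nonempty := by
        rw [← card_pos, card_compl, Fintype.card_fin]
        have h1 := card_union_add_card_inter I J
        omega
      have hre := congrArg Complex.re hrec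
      have him := congrArg Complex.im hrec
      rw [Complex.re_sum, Complex.mul_re, Complex.natCast_re, Complex.natCast_im] at hre
      rw [Complex.im_sum, Complex.mul_im, Complex.natCast_re, Complex.natCast_im] at him
      rw [sum_eq_zero (fun m hm => (hpos m hm).2)] at him
      have hs := sum_pos (fun m hm => (hpos m hm).1) hnon
      have hd : (0 : ℝ) < ((d + 1 : ℕ) : ℝ) := by positivity
      constructor
      · rw [← hre, zero_mul, sub_zero] at hs
        exact pos_of_mul_pos_right hs hd.le
      · rw [zero_mul, add_zero] at him
        exact (mul_eq_zero.1 him).resolve_left hd.ne'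
    · intro h
      rw [sum_eq_zero (fun m hm => (hterm m hm).2.2 (by rw [(hterm m hm).1]; omega))] at hrec
      exact (mul_eq_zero.1 hrec).resolve_left hne

/-- (Evenness corollary.) Let `P` be a rank-`k` orthogonal projection
all of whose `k×k` minors are positive reals, let `1 ≤ l ≤ k`, and let `I, J` be
`l`-subsets (identified with their 1-indexed values `c+1` for `c : Fin n`) satisfying
the evenness condition: for all integers `a < b` lying outside `I ∪ J`, the number of
elements of `I` strictly between `a` and `b` plus the number of elements of `J`
strictly between `a` and `b` is even. Then `Δ_{I,J}(P)` is a positive real if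
`|I ∩ J| ≥ k + l − n`, and `Δ_{I,J}(P) = 0` if `|I ∩ J| < k + l − n`. -/
theorem evenness_minors_of_projection {n k l : ℕ} (hk1 : 1 ≤ k) (hkn : k ≤ n)
    (P : Matrix (Fin n) (Fin n) ℂ) (hP2 : P * P = P) (hPH : P.conjTranspose = P)
    (hPrank : P.rank = k)
    (hPpos : ∀ I J : Finset (Fin n), I.card = k → J.card = k → IsPosReal (minorOn P I J))
    (hl1 : 1 ≤ l) (hlk : l ≤ k)
    (I J : Finset (Fin n)) (hI : I.card = l) (hJ : J.card = l)
    (heven : ∀ a b : ℤ, a < b →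
      (¬ ∃ c ∈ I ∪ J, ((c : ℕ) : ℤ) + 1 = a) →
      (¬ ∃ c ∈ I ∪ J, ((c : ℕ) : ℤ) + 1 = b) →
      Even ((I.filter fun c : Fin n => a < ((c : ℕ) : ℤ) + 1 ∧ ((c : ℕ) : ℤ) + 1 < b).card +
        (J.filter fun c : Fin n => a < ((c : ℕ) : ℤ) + 1 ∧ ((c : ℕ) : ℤ) + 1 < b).card)) :
    (k + l ≤ (I ∩ J).card + n → IsPosReal (minorOn P I J)) ∧
    ((I ∩ J).card + n < k + l → minorOn P I J = 0) := by
  exact aux_main P hP2 hPrank hPpos (k - l) l hl1 (by omega) I J hI hJ heven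
end

section
/- Let λ ∈ ℝⁿ be weakly decreasing and nonconstant, and let L be an n×n complex matrix that is tridiagonal (L_{ij} = 0 whenever |i−j| ≥ 2) and satisfies L = g·diag(λ₁,…,λₙ)·g* for some unitary g (i.e., L is Hermitian with eigenvalue multiset {λ₁,…,λₙ}). Then: (a) L ∈ O_λ^{>0} if and only if L is a real symmetric matrix with L_{i,i+1} > 0 for all 1 ≤ i ≤ n−1; moreover, if L ∈ O_λ^{>0} then λ is strictly decreasing — in particular, if λ is not strictly decreasing then O_λ^{>0} contains no tridiagonal matrix. (b) L ∈ O_λ^{≥0} if and only if L is a real symmetric matrix with L_{i,i+1} ≥ 0 for all 1 ≤ i ≤ n−1. -/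
open Matrix Finset

/-- The totally positive part `O_λ^{>0}` of the adjoint orbit: Hermitian matrices
`g · diag(λ) · g*` with `g ∈ U_n^{>0}`. -/
def OrbitTP {n : ℕ} (lam : Fin n → ℝ) : Set (Matrix (Fin n) (Fin n) ℂ) :=
  {L | ∃ g ∈ UnitaryTP n,
    L = g * Matrix.diagonal (fun i => (lam i : ℂ)) * g.conjTranspose}

/-- The totally nonnegative part `O_λ^{≥0}`: the closure of `O_λ^{>0}` in the space of
`n×n` complex matrices. -/
noncomputable def OrbitTNN {n : ℕ} (lam : Fin n → ℝ) : Set (Matrix (Fin n) (Fin n) ℂ) :=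
  closure (OrbitTP lam)

section Helpers

open scoped ComplexOrder

/-- Cauchy–Binet. -/
theorem cauchyBinet {R : Type*} [CommRing R] {k n : ℕ} (A : Matrix (Fin k) (Fin n) R)
    (B : Matrix (Fin n) (Fin k) R) :
    (A * B).det = ∑ s : Fin k ↪o Fin n, (A.submatrix id s).det * (B.submatrix s id).det := by
  classical
  have h1 : (A * B).det = ∑ s : Fin k → Fin n, (∏ a, A a (s a)) * (B.submatrix s id).det := by
    have e : (A * B) = fun a => ∑ i, A a i • B i := by
      funext a b
      simp [Matrix.mul_apply]
    have h := (Matrix.detRowAlternating (n := Fin k) (R := R)).toMultilinearMap.map_sum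
      (fun a i => A a i • B i)
    have h' : (A * B).det = (Matrix.detRowAlternating (n := Fin k) (R := R)).toMultilinearMap
      (fun a => ∑ i, A a i • B i) := by
      rw [e]; rfl
    rw [h', h]
    refine Finset.sum_congr rfl fun s _ => ?_
    rw [MultilinearMap.map_smul_univ]
    rfl
  have h2 : ∀ s : Fin k ↪o Fin n, (A.submatrix id s).det * (B.submatrix s id).det
      = ∑ σ : Equiv.Perm (Fin k), (∏ a, A a (s (σ a))) * (B.submatrix (s ∘ σ) id).det := by
    intro s
    rw [← Matrix.det_transpose, Matrix.det_apply', Finset.sum_mul]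
    refine Finset.sum_congr rfl fun σ _ => ?_
    have : (B.submatrix (s ∘ σ) id) = (B.submatrix s id).submatrix σ id := rfl
    rw [this, Matrix.det_permute]
    simp only [Matrix.transpose_apply, Matrix.submatrix_apply, id]
    ring
  rw [h1, Finset.sum_congr rfl fun s _ => h2 s, ← Fintype.sum_prod_type'
    (f := fun (s : Fin k ↪o Fin n) (σ : Equiv.Perm (Fin k)) =>
      (∏ a, A a (s (σ a))) * (B.submatrix (s ∘ σ) id).det)]
  symm
  refine Finset.sum_of_injOn (fun p : (Fin k ↪o Fin n) × Equiv.Perm (Fin k) => (p.1 ∘ p.2)) ?_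
    (by simp) ?_ (fun p _ => rfl)
  · rintro ⟨s, σ⟩ - ⟨t, τ⟩ - h
    simp only at h
    have hr : Set.range s = Set.range t := by
      rw [← σ.surjective.range_comp s, ← τ.surjective.range_comp t, h]
    have hst : s = t := OrderEmbedding.range_inj.1 hr
    subst hst
    have : σ = τ := by
      ext a
      have := congrFun h a
      simpa using congrArg Fin.val (s.injective this)
    rw [this]
  · intro s _ hs
    by_cases hinj : Function.Injective s
    · exfalso
      apply hs
      have hm : StrictMono (s ∘ Tuple.sort s) :=
        (Tuple.monotone_sort s).strictMono_of_injective (hinj.comp (Tuple.sort s).injective)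
      refine ⟨(OrderEmbedding.ofStrictMono _ hm, (Tuple.sort s)⁻¹), by simp, ?_⟩
      funext a
      simp
    · simp only [Function.Injective, not_forall] at hinj
      obtain ⟨a, b, hab, hne⟩ := hinj
      rw [Matrix.det_zero_of_row_eq hne, mul_zero]
      funext c
      simp [hab]

theorem submatrix_update {R : Type*} {k n m : ℕ} (A : Matrix (Fin n) (Fin m) R)
    (s : Fin k → Fin n) (t : Fin k → Fin m) (a : Fin k) (j : Fin n) :
    A.submatrix (Function.update s a j) t = (A.submatrix s t).updateRow a (fun b => A j (t b)) := by
  ext c d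
  by_cases h : c = a
  · subst h; simp
  · simp [h]

/-- Moving one index to an adjacent position. -/
theorem update_adj {k n : ℕ} (s : Fin k ↪o Fin n) (a : Fin k) (j : Fin n)
    (hj : (j : ℕ) = s a + 1 ∨ (s a : ℕ) = j + 1) (hr : ∀ c, s c ≠ j) :
    StrictMono (Function.update s a j) := by
  intro c d hcd
  have hlt : ∀ c d, c < d → (s c : ℕ) < s d := fun c d h => s.strictMono h
  have hr' : ∀ c, (s c : ℕ) ≠ j := fun c h => hr c (Fin.ext h)
  by_cases hc : c = a
  · subst hc
    have hd : d ≠ c := hcd.ne'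
    rw [Function.update_self, Function.update_of_ne hd, Fin.lt_def]
    have := hlt _ _ hcd
    have := hr' d
    omega
  · by_cases hd : d = a
    · subst hd
      rw [Function.update_self, Function.update_of_ne hc, Fin.lt_def]
      have := hlt _ _ hcd
      have := hr' c
      omega
    · rw [Function.update_of_ne hc, Function.update_of_ne hd]
      exact s.strictMono hcd

theorem det_update_zero {R : Type*} [CommRing R] {k n m : ℕ} (A : Matrix (Fin n) (Fin m) R)
    (s : Fin k ↪o Fin n) (t : Fin k → Fin m) (a : Fin k) (j : Fin n) (c : Fin k) (hc : s c = j)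
    (hca : c ≠ a) : (A.submatrix (Function.update s a j) t).det = 0 := by
  refine Matrix.det_zero_of_row_eq hca ?_
  funext b
  simp [hca, hc]

/-- Entry of the projection onto a totally positive subspace. -/
theorem proj_entry {k n : ℕ} (A : Matrix (Fin n) (Fin k) ℂ) (hA : Aᴴ * A = 1) (i j : Fin n) 
    (hij : i ≠ j) :
    ∑ b, A j b * star (A i b) = ∑ s : Fin k ↪o Fin n, star (A.submatrix s id).det *
      ∑ a, if s a = i then (A.submatrix (Function.update s a j) id).det else 0 := by
  classical
  have e1 : (Aᴴ * (A + Matrix.single i j (1:ℂ) * A)).det = 1 + ∑ b, A j b * star (A i b) := by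
    have : Aᴴ * (A + Matrix.single i j (1:ℂ) * A) = 1 + Matrix.replicateCol Unit (fun b => star (A i b))
        * Matrix.replicateRow Unit (fun b => A j b) := by
      rw [Matrix.mul_add, hA]
      congr 1
      ext b c
      simp [Matrix.mul_apply, Matrix.single_apply, Finset.sum_ite_eq, ite_and]
    rw [this, Matrix.det_one_add_replicateCol_mul_replicateRow]
    simp [dotProduct]
  have e2 : (1 : ℂ) = ∑ s : Fin k ↪o Fin n, star (A.submatrix s id).det *
      (A.submatrix s id).det := by
    have := cauchyBinet Aᴴ A
    rw [hA, Matrix.det_one] at this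
    rw [this]
    refine Finset.sum_congr rfl fun s _ => ?_
    rw [← Matrix.det_conjTranspose]
    rfl
  have e3 := cauchyBinet Aᴴ (A + Matrix.single i j (1:ℂ) * A)
  rw [e1] at e3
  have e4 : ∀ s : Fin k ↪o Fin n, ((A + Matrix.single i j (1:ℂ) * A).submatrix s id).det
      = (A.submatrix s id).det +
      ∑ a, if s a = i then (A.submatrix (Function.update s a j) id).det else 0 := by
    intro s
    by_cases h : ∃ a, s a = i
    · obtain ⟨a, ha⟩ := h
      have hu : ∀ c, (s c = i ↔ c = a) := fun c => by
        rw [← ha]; exact s.injective.eq_iff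
      simp only [hu, Finset.sum_ite_eq', Finset.mem_univ, if_true]
      rw [submatrix_update]
      have : (A + Matrix.single i j (1:ℂ) * A).submatrix s id =
        (A.submatrix s id).updateRow a ((A.submatrix s id) a + fun b => A j (id b)) := by
        ext c d
        by_cases hc : c = a
        · subst hc
          simp [Matrix.mul_apply, Matrix.single_apply, ha, ite_and]
        · have : i ≠ s c := fun h => hc ((hu c).1 h.symm)
          simp [hc, Matrix.mul_apply, Matrix.single_apply, this]
      rw [this, Matrix.det_updateRow_add, Matrix.updateRow_eq_self]
    · push Not at h
      have : (A + Matrix.single i j (1:ℂ) * A).submatrix s id = A.submatrix s id := by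
        ext c d
        have : i ≠ s c := fun h' => h c h'.symm
        simp [Matrix.mul_apply, Matrix.single_apply, this]
      rw [this]
      simp [h]
  have e5 : ∀ s : Fin k ↪o Fin n, (Aᴴ.submatrix id s).det = star (A.submatrix s id).det := by
    intro s
    rw [← Matrix.det_conjTranspose]
    rfl
  simp only [e4, e5, mul_add, Finset.sum_add_distrib] at e3
  rw [← e2] at e3
  exact add_left_cancel e3

theorem proj_entry_pos {k n : ℕ} (hk : 0 < k) (hkn : k < n) (A : Matrix (Fin n) (Fin k) ℂ)
    (hA : Aᴴ * A = 1) (hpos : ∀ s : Fin k ↪o Fin n, 0 < (A.submatrix s id).det) (i j : Fin n)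
    (hij : (j : ℕ) = i + 1 ∨ (i : ℕ) = j + 1) :
    0 < ∑ b, A j b * star (A i b) := by
  classical
  have hne : i ≠ j := by rintro rfl; omega
  rw [proj_entry A hA i j hne]
  have hst : ∀ s : Fin k ↪o Fin n, 0 < star (A.submatrix s id).det := by
    intro s
    exact star_pos_iff.2 (hpos s)
  have hterm : ∀ (s : Fin k ↪o Fin n) (a : Fin k), 0 ≤
      if s a = i then (A.submatrix (Function.update s a j) id).det else 0 := by
    intro s a
    split_ifs with h
    · by_cases hr : ∃ c, s c = j
      · obtain ⟨c, hc⟩ := hr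
        rw [det_update_zero A s id a j c hc (by rintro rfl; exact hne (h.symm.trans hc))]
      · push Not at hr
        exact (hpos (OrderEmbedding.ofStrictMono _ (update_adj s a j (by rw [h]; exact hij) hr))).le
    · exact le_rfl
  obtain ⟨I, hI1, hI2, hI3⟩ : ∃ I : Finset (Fin n), {i} ⊆ I ∧ I ⊆ univ.erase j ∧ I.card = k := by
    refine Finset.exists_subsuperset_card_eq ?_ ?_ ?_
    · simp [hne]
    · rw [Finset.card_singleton]; exact hk
    · rw [Finset.card_erase_of_mem (Finset.mem_univ _), Finset.card_univ, Fintype.card_fin]; omega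
  set s := I.orderEmbOfFin hI3
  have hsI : ∀ a, s a ∈ I := fun a => Finset.orderEmbOfFin_mem I hI3 a
  have hsj : ∀ c, s c ≠ j := fun c h => by
    have := hI2 (hsI c)
    rw [h] at this
    simp at this
  have hsi : ∃ a, s a = i := by
    have : i ∈ Set.range s := by
      rw [Finset.range_orderEmbOfFin]
      exact hI1 (by simp)
    exact this
  obtain ⟨a, ha⟩ := hsi
  refine Finset.sum_pos' (fun s _ => mul_nonneg (hst s).le (Finset.sum_nonneg fun a _ => hterm s a))
    ⟨s, Finset.mem_univ _, mul_pos (hst s) ?_⟩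
  refine Finset.sum_pos' (fun a _ => hterm s a) ⟨a, Finset.mem_univ _, ?_⟩
  rw [if_pos ha]
  exact hpos (OrderEmbedding.ofStrictMono _ (update_adj s a j (by rw [ha]; exact hij) hsj))

theorem leftMinor_eq {R : Type} [CommRing R] {n : ℕ} (g : Matrix (Fin n) (Fin n) R)
    (I : Finset (Fin n)) (h : I.card ≤ n) :
    leftMinor g I = (g.submatrix (I.orderEmbOfFin rfl) (Fin.castLE h)).det := by
  have hJ : (Finset.univ.filter fun j : Fin n => (j : ℕ) < I.card).card = I.card := by
    rw [Fin.card_filter_val_lt]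
    omega
  unfold leftMinor minorOn
  rw [dif_pos hJ]
  congr 1
  have := Finset.orderEmbOfFin_unique hJ (f := Fin.castLE h) (fun x => by simp)
    (Fin.strictMono_castLE h)
  ext a b
  simp only [Matrix.of_apply, Matrix.submatrix_apply, this]
  rfl

theorem leftMinor_image {R : Type} [CommRing R] {n k : ℕ} (g : Matrix (Fin n) (Fin n) R)
    (s : Fin k ↪o Fin n) (h : k ≤ n) :
    ∃ I : Finset (Fin n), leftMinor g I = (g.submatrix s (Fin.castLE h)).det := by
  classical
  obtain ⟨I, hI, hs⟩ : ∃ I : Finset (Fin n), ∃ hI : I.card = k, s = I.orderEmbOfFin hI := by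
    refine ⟨Finset.univ.image s, ?_, ?_⟩
    · rw [Finset.card_image_of_injective _ s.injective]; simp
    · exact Finset.orderEmbOfFin_unique' _ (fun x => by simp)
  refine ⟨I, ?_⟩
  subst hI
  rw [leftMinor_eq g I h, hs]

theorem isPosReal_iff (z : ℂ) : IsPosReal z ↔ 0 < z := by
  rw [Complex.pos_iff]
  unfold IsPosReal
  constructor
  · rintro ⟨h1, h2⟩; exact ⟨h1, h2.symm⟩
  · rintro ⟨h1, h2⟩; exact ⟨h1, h2.symm⟩

theorem abel_sum (l c : ℕ → ℂ) (N : ℕ) :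
    ∑ m ∈ range N, l m * c m = l N * (∑ m ∈ range N, c m) +
      ∑ m ∈ range N, (l m - l (m + 1)) * ∑ m' ∈ range (m + 1), c m' := by
  induction N with
  | zero => simp
  | succ N ih =>
    rw [Finset.sum_range_succ, ih, Finset.sum_range_succ _ N, Finset.sum_range_succ _ N,
      Finset.sum_range_succ _ N]
    ring

/-- Adjacent entries of elements of the positive orbit are positive. -/
theorem orbit_entry_pos {n : ℕ} (lam : Fin n → ℝ) (hanti : Antitone lam)
    (hnc : ∃ a b : Fin n, lam a ≠ lam b) (L : Matrix (Fin n) (Fin n) ℂ) (hL : L ∈ OrbitTP lam)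
    (i j : Fin n) (hij : (j : ℕ) = i + 1) : 0 < L i j := by
  obtain ⟨g, ⟨hg, hm⟩, rfl⟩ := hL
  have hn : 0 < n := i.pos
  let f : ℕ → Fin n := fun m => ⟨min m (n - 1), by omega⟩
  have hf : ∀ m : Fin n, f m = m := fun m => by
    apply Fin.ext
    simp only [f]
    omega
  have hfm : Monotone f := by
    intro a b hab
    simp only [f, Fin.le_def]
    omega
  let l : ℕ → ℝ := fun m => lam (f m)
  have hl : Antitone l := fun a b hab => hanti (hfm hab)
  let c : ℕ → ℂ := fun m => g i (f m) * star (g j (f m))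
  have e : (g * Matrix.diagonal (fun i => (lam i : ℂ)) * gᴴ) i j =
      ∑ m ∈ range n, (l m : ℂ) * c m := by
    rw [← Fin.sum_univ_eq_sum_range (fun m => (l m : ℂ) * c m)]
    rw [Matrix.mul_apply]
    refine Finset.sum_congr rfl fun m _ => ?_
    simp only [Matrix.mul_diagonal, l, c, hf, Matrix.conjTranspose_apply]
    ring
  have hP : ∀ k, 0 < k → k < n → 0 < ∑ m ∈ range k, c m := by
    intro k hk hkn
    have hA : (g.submatrix id (Fin.castLE hkn.le))ᴴ * (g.submatrix id (Fin.castLE hkn.le)) = 1 := by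
      have : (gᴴ * g).submatrix (Fin.castLE hkn.le) (Fin.castLE hkn.le) = 1 := by
        rw [hg]
        exact Matrix.submatrix_one _ (Fin.castLE_injective _)
      rw [← this]
      ext a b
      simp [Matrix.mul_apply]
    have := proj_entry_pos hk hkn (g.submatrix id (Fin.castLE hkn.le)) hA (fun s => by
      obtain ⟨I, hI⟩ := leftMinor_image g s hkn.le
      have h2 := hm I
      rw [isPosReal_iff, hI] at h2
      exact h2) j i (Or.inr hij)
    rw [← Fin.sum_univ_eq_sum_range c]
    convert this using 2 with b
    simp only [c, Matrix.submatrix_apply, id]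
    rw [show f (b : ℕ) = Fin.castLE hkn.le b from hf (Fin.castLE hkn.le b)]
  have hPn : ∑ m ∈ range n, c m = 0 := by
    rw [← Fin.sum_univ_eq_sum_range c]
    have hg' : g * gᴴ = 1 := mul_eq_one_comm.1 hg
    have := congrFun (congrFun hg' i) j
    rw [Matrix.mul_apply, Matrix.one_apply_ne (by rintro rfl; omega)] at this
    rw [← this]
    refine Finset.sum_congr rfl fun m _ => ?_
    simp only [c, hf, Matrix.conjTranspose_apply]
  rw [e, abel_sum, hPn, mul_zero, zero_add]
  have hd : ∀ m, (0 : ℂ) ≤ (l m : ℂ) - l (m + 1) := fun m => by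
    rw [← Complex.ofReal_sub, Complex.zero_le_real]
    exact sub_nonneg.2 (hl (Nat.le_succ m))
  have hP' : ∀ k ∈ range n, 0 ≤ ∑ m ∈ range (k + 1), c m := by
    intro k hk
    rw [Finset.mem_range] at hk
    rcases (Nat.succ_le_of_lt hk).lt_or_eq with h | h
    · exact (hP (k + 1) (Nat.succ_pos _) h).le
    · have h' : k + 1 = n := h
      rw [h', hPn]
  obtain ⟨m, hmn, hml⟩ : ∃ m, m + 1 < n ∧ l (m + 1) < l m := by
    by_contra hcon
    push Not at hcon
    have : ∀ m, m < n → l m = l 0 := by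
      intro m
      induction m with
      | zero => intro _; rfl
      | succ m ih =>
        intro hm'
        rw [← ih (by omega)]
        exact le_antisymm (hl (Nat.le_succ m)) (hcon m hm')
    obtain ⟨a, b, hab⟩ := hnc
    apply hab
    have ha := this a a.2
    have hb := this b b.2
    simp only [l, hf] at ha hb
    rw [ha, hb]
  refine Finset.sum_pos' (fun k hk => mul_nonneg (hd k) (hP' k hk)) ⟨m, ?_, ?_⟩
  · rw [Finset.mem_range]; omega
  · refine mul_pos ?_ (hP (m + 1) (Nat.succ_pos _) hmn)
    rw [← Complex.ofReal_sub]
    exact_mod_cast sub_pos.2 hml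

/-- Perron–Frobenius type lemma: the top eigenvector has constant sign. -/
theorem perron_sign {ι : Type*} [Fintype ι] [DecidableEq ι] (D T : Matrix ι ι ℝ) (mu : ι → ℝ)
    (t0 : ι) (hT : T * Tᵀ = 1) (hD : D * T = T * Matrix.diagonal mu)
    (hmu : ∀ t, t ≠ t0 → mu t < mu t0) (hoff : ∀ s t, s ≠ t → 0 ≤ D s t) :
    (∀ s, 0 ≤ T s t0) ∨ (∀ s, T s t0 ≤ 0) := by
  have hT' : Tᵀ * T = 1 := mul_eq_one_comm.1 hT
  set x : ι → ℝ := fun s => T s t0 with hx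
  set y : ι → ℝ := fun s => |T s t0| with hy
  set c : ι → ℝ := Tᵀ *ᵥ y with hc
  have hyc : y = T *ᵥ c := by
    rw [hc, Matrix.mulVec_mulVec, hT, Matrix.one_mulVec]
  clear_value c
  have hDx : D *ᵥ x = mu t0 • x := by
    funext s
    have := congrFun (congrFun hD s) t0
    rw [Matrix.mul_diagonal, Matrix.mul_apply] at this
    simp only [Matrix.mulVec, dotProduct, Pi.smul_apply, smul_eq_mul, hx]
    rw [this, mul_comm]
  have hyy : y ⬝ᵥ y = c ⬝ᵥ c := by
    rw [hyc, Matrix.dotProduct_mulVec, Matrix.vecMul_mulVec, hT', Matrix.vecMul_one]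
  have hyDy : y ⬝ᵥ (D *ᵥ y) = ∑ t, mu t * c t ^ 2 := by
    rw [hyc, Matrix.mulVec_mulVec, hD, ← Matrix.mulVec_mulVec, Matrix.dotProduct_mulVec,
      Matrix.vecMul_mulVec, hT', Matrix.vecMul_one]
    simp only [dotProduct, Matrix.mulVec_diagonal]
    exact Finset.sum_congr rfl fun t _ => by ring
  have hxx : x ⬝ᵥ x = y ⬝ᵥ y := by
    simp only [dotProduct, hx, hy]
    exact Finset.sum_congr rfl fun t _ => by rw [abs_mul_abs_self]
  have hle : x ⬝ᵥ (D *ᵥ x) ≤ y ⬝ᵥ (D *ᵥ y) := by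
    simp only [dotProduct, Matrix.mulVec, Finset.mul_sum]
    refine Finset.sum_le_sum fun s _ => Finset.sum_le_sum fun t _ => ?_
    by_cases hst : s = t
    · subst hst
      have : |T s t0| * |T s t0| = T s t0 * T s t0 := abs_mul_abs_self _
      simp only [hx, hy]
      exact le_of_eq (by linear_combination (-(D s s)) * this)
    · have h1 := hoff s t hst
      have h2 : T s t0 * T t t0 ≤ |T s t0| * |T t t0| := by
        rw [← abs_mul]; exact le_abs_self _
      simp only [hx, hy]
      nlinarith [mul_le_mul_of_nonneg_left h2 h1]
  have hsum : ∑ t, (mu t0 - mu t) * c t ^ 2 ≤ 0 := by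
    have h1 : x ⬝ᵥ (D *ᵥ x) = ∑ t, mu t0 * c t ^ 2 := by
      rw [hDx, dotProduct_smul, hxx, hyy, smul_eq_mul, dotProduct, Finset.mul_sum]
      exact Finset.sum_congr rfl fun t _ => by ring
    rw [h1, hyDy] at hle
    simp only [sub_mul, Finset.sum_sub_distrib]
    linarith
  have hnn : ∀ t ∈ Finset.univ, 0 ≤ (mu t0 - mu t) * c t ^ 2 := by
    intro t _
    by_cases h : t = t0
    · subst h; simp
    · exact mul_nonneg (sub_nonneg.2 (hmu t h).le) (sq_nonneg _)
  have hz : ∀ t, t ≠ t0 → c t = 0 := by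
    intro t ht
    have := (Finset.sum_eq_zero_iff_of_nonneg hnn).1 (le_antisymm hsum (Finset.sum_nonneg hnn)) t
      (Finset.mem_univ _)
    rcases mul_eq_zero.1 this with h | h
    · have := hmu t ht
      linarith
    · exact pow_eq_zero_iff (two_ne_zero) |>.1 h
  have hyx : ∀ s, |T s t0| = T s t0 * c t0 := by
    intro s
    have : y s = (T *ᵥ c) s := by rw [← hyc]
    rw [Matrix.mulVec, dotProduct, Finset.sum_eq_single t0] at this
    · exact this
    · intro t _ ht; rw [hz t ht, mul_zero]
    · simp
  rcases le_total 0 (c t0) with h | h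
  · left
    intro s
    by_contra hs
    push Not at hs
    have h1 := hyx s
    have h2 : 0 < |T s t0| := abs_pos.2 hs.ne
    nlinarith [mul_nonneg h (neg_nonneg.2 hs.le)]
  · right
    intro s
    by_contra hs
    push Not at hs
    have h1 := hyx s
    have h2 : 0 < |T s t0| := abs_pos.2 hs.ne'
    nlinarith [mul_nonneg hs.le (neg_nonneg.2 h)]

theorem sum_updateRow_eq {k : ℕ} (X Y : Matrix (Fin k) (Fin k) ℝ) :
    ∑ a, (X.updateRow a (Y a)).det = ∑ b, (X.updateCol b (fun a => Y a b)).det := by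
  have h1 : ∀ b, (X.updateCol b (fun a => Y a b)).det = ∑ a, X.adjugate b a * Y a b := by
    intro b
    rw [← Matrix.cramer_apply, Matrix.cramer_eq_adjugate_mulVec]
    rfl
  have h2 : ∀ a, (X.updateRow a (Y a)).det = ∑ b, X.adjugate b a * Y a b := by
    intro a
    rw [← Matrix.det_transpose, ← Matrix.updateCol_transpose, ← Matrix.cramer_apply,
      Matrix.cramer_eq_adjugate_mulVec, ← Matrix.adjugate_transpose]
    rfl
  simp only [h1, h2]
  exact Finset.sum_comm

/-- The derivation induced by `R` on the `k`-th exterior power. -/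
def derivMat {n : ℕ} (k : ℕ) (R : Matrix (Fin n) (Fin n) ℝ) :
    Matrix (Fin k ↪o Fin n) (Fin k ↪o Fin n) ℝ :=
  fun s s' => ∑ a, ∑ l, if (s' : Fin k → Fin n) = Function.update s a l then R (s a) l else 0

/-- Real symmetric tridiagonal with positive off-diagonal entries. -/
structure IsJac {n : ℕ} (R : Matrix (Fin n) (Fin n) ℝ) : Prop where
  symm : Rᵀ = R
  tri : ∀ i j : Fin n, ((i : ℕ) + 2 ≤ (j : ℕ) ∨ (j : ℕ) + 2 ≤ (i : ℕ)) → R i j = 0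
  pos : ∀ i j : Fin n, (j : ℕ) = (i : ℕ) + 1 → 0 < R i j

theorem IsJac.pos' {n : ℕ} {R : Matrix (Fin n) (Fin n) ℝ} (h : IsJac R) (i j : Fin n)
    (hij : (j : ℕ) = i + 1 ∨ (i : ℕ) = j + 1) : 0 < R i j := by
  rcases hij with hij | hij
  · exact h.pos i j hij
  · rw [← h.symm]; exact h.pos j i hij

theorem IsJac.nonneg {n : ℕ} {R : Matrix (Fin n) (Fin n) ℝ} (h : IsJac R) (i j : Fin n)
    (hij : i ≠ j) : 0 ≤ R i j := by
  by_cases h' : (j : ℕ) = i + 1 ∨ (i : ℕ) = j + 1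
  · exact (h.pos' i j h').le
  · refine (h.tri i j ?_).ge
    have : (i : ℕ) ≠ j := fun h => hij (Fin.ext h)
    omega

theorem derivMat_term_nonneg {n k : ℕ} {R : Matrix (Fin n) (Fin n) ℝ} (h : IsJac R)
    (s s' : Fin k ↪o Fin n) (hs : s ≠ s') (a : Fin k) (l : Fin n) :
    0 ≤ if (s' : Fin k → Fin n) = Function.update s a l then R (s a) l else 0 := by
  split_ifs with hu
  · apply h.nonneg
    rintro rfl
    rw [Function.update_eq_self] at hu
    exact hs (DFunLike.coe_injective hu.symm)
  · exact le_rfl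

theorem derivMat_nonneg {n k : ℕ} {R : Matrix (Fin n) (Fin n) ℝ} (h : IsJac R)
    (s s' : Fin k ↪o Fin n) (hs : s ≠ s') : 0 ≤ derivMat k R s s' :=
  Finset.sum_nonneg fun a _ => Finset.sum_nonneg fun l _ => derivMat_term_nonneg h s s' hs a l

theorem derivMat_pos {n k : ℕ} {R : Matrix (Fin n) (Fin n) ℝ} (h : IsJac R)
    (s s' : Fin k ↪o Fin n) (a : Fin k) (l : Fin n)
    (hs' : (s' : Fin k → Fin n) = Function.update s a l)
    (hij : (l : ℕ) = s a + 1 ∨ (s a : ℕ) = l + 1) : 0 < derivMat k R s s' := by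
  have hs : s ≠ s' := by
    rintro rfl
    have := congrFun hs' a
    rw [Function.update_self] at this
    rw [this] at hij
    omega
  refine Finset.sum_pos' (fun a _ => Finset.sum_nonneg fun l _ => derivMat_term_nonneg h s s' hs a l)
    ⟨a, Finset.mem_univ _, ?_⟩
  refine Finset.sum_pos' (fun l _ => derivMat_term_nonneg h s s' hs a l) ⟨l, Finset.mem_univ _, ?_⟩
  rw [if_pos hs']
  exact h.pos' _ _ hij

/-- The `k`-th compound matrix. -/
noncomputable def compoundMat {n : ℕ} (k : ℕ) (g : Matrix (Fin n) (Fin n) ℝ) :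
    Matrix (Fin k ↪o Fin n) (Fin k ↪o Fin n) ℝ :=
  fun s t => (g.submatrix s t).det

theorem compoundMat_orth {n k : ℕ} (g : Matrix (Fin n) (Fin n) ℝ) (hg : g * gᵀ = 1) :
    compoundMat k g * (compoundMat k g)ᵀ = 1 := by
  ext s s'
  have h := cauchyBinet (g.submatrix s id) (gᵀ.submatrix id s')
  rw [← Matrix.submatrix_mul g gᵀ s id s' Function.bijective_id, hg] at h
  have h2 : (compoundMat k g * (compoundMat k g)ᵀ) s s' = 
      ((1 : Matrix (Fin n) (Fin n) ℝ).submatrix s s').det := by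
    rw [h, Matrix.mul_apply]
    refine Finset.sum_congr rfl fun t _ => ?_
    congr 1
    rw [← Matrix.det_transpose]
    rfl
  rw [h2]
  by_cases hs : s = s'
  · subst hs
    rw [Matrix.submatrix_one _ s.injective]
    simp
  · rw [Matrix.one_apply_ne hs]
    have : ∃ a, ∀ b, s a ≠ s' b := by
      by_contra hcon
      push Not at hcon
      apply hs
      apply OrderEmbedding.range_inj.1
      have hsub : Set.range s ⊆ Set.range s' := by
        rintro _ ⟨a, rfl⟩
        obtain ⟨b, hb⟩ := hcon a
        exact ⟨b, hb.symm⟩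
      apply Set.eq_of_subset_of_ncard_le hsub _ (Set.toFinite _)
      rw [Set.ncard_range_of_injective s.injective, Set.ncard_range_of_injective s'.injective]
    obtain ⟨a, ha⟩ := this
    apply Matrix.det_eq_zero_of_row_eq_zero a
    intro b
    simp [Matrix.one_apply, ha b]

theorem det_updateRow_expand {n k : ℕ} (g : Matrix (Fin n) (Fin n) ℝ)
    (s t : Fin k → Fin n) (a : Fin k) (r : Fin n → ℝ) :
    ((g.submatrix s t).updateRow a (∑ l, r l • (fun b => g l (t b)))).det =
      ∑ l, r l * (g.submatrix (Function.update s a l) t).det := by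
  have h := map_sum ((Matrix.detRowAlternating (n := Fin k) (R := ℝ)).toMultilinearMap.toLinearMap
    (g.submatrix s t) a) (fun l => r l • (fun b => g l (t b))) Finset.univ
  refine Eq.trans h ?_
  refine Finset.sum_congr rfl fun l _ => ?_
  rw [map_smul, smul_eq_mul, submatrix_update]
  rfl

theorem derivMat_mul {n k : ℕ} {R : Matrix (Fin n) (Fin n) ℝ} (h : IsJac R)
    (g : Matrix (Fin n) (Fin n) ℝ) (lam : Fin n → ℝ) (hR : R * g = g * Matrix.diagonal lam) :
    derivMat k R * compoundMat k g = compoundMat k g * Matrix.diagonal (fun t => ∑ b, lam (t b)) := by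
  ext s t
  rw [Matrix.mul_diagonal, Matrix.mul_apply]
  have h1 : ∑ s', derivMat k R s s' * compoundMat k g s' t =
      ∑ a, ∑ l, R (s a) l * (g.submatrix (Function.update s a l) t).det := by
    simp only [derivMat, Finset.sum_mul]
    rw [Finset.sum_comm]
    refine Finset.sum_congr rfl fun a _ => ?_
    rw [Finset.sum_comm]
    refine Finset.sum_congr rfl fun l _ => ?_
    by_cases hu : StrictMono (Function.update s a l)
    · rw [Finset.sum_eq_single (OrderEmbedding.ofStrictMono _ hu)]
      · rw [if_pos (by rfl)]
        rfl
      · intro s' _ hs'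
        rw [if_neg, zero_mul]
        intro h'
        exact hs' (DFunLike.coe_injective h')
      · simp
    · have hz : R (s a) l * (g.submatrix (Function.update s a l) t).det = 0 := by
        by_cases hadj : (l : ℕ) = s a + 1 ∨ (s a : ℕ) = l + 1
        · by_cases hr : ∃ c, s c = l
          · obtain ⟨c, hc⟩ := hr
            rw [det_update_zero g s t a l c hc, mul_zero]
            rintro rfl
            rw [hc] at hadj
            omega
          · push Not at hr
            exact absurd (update_adj s a l hadj hr) hu
        · have : s a ≠ l := by
            rintro rfl
            rw [Function.update_eq_self] at hu
            exact hu s.strictMono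
          have : (s a : ℕ) ≠ l := fun h => this (Fin.ext h)
          rw [h.tri _ _ (by omega), zero_mul]
      rw [hz]
      apply Finset.sum_eq_zero
      intro s' _
      rw [if_neg, zero_mul]
      intro h'
      exact hu (h' ▸ s'.strictMono)
  rw [h1]
  have h2 : ∀ a, ∑ l, R (s a) l * (g.submatrix (Function.update s a l) t).det =
      ((g.submatrix s t).updateRow a
        ((Matrix.of fun a b => g (s a) (t b) * lam (t b) : Matrix (Fin k) (Fin k) ℝ) a)).det := by
    intro a
    have e : (Matrix.of fun a b => g (s a) (t b) * lam (t b) : Matrix (Fin k) (Fin k) ℝ) a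
        = ∑ l, R (s a) l • (fun b => g l (t b)) := by
      funext b
      have := congrFun (congrFun hR (s a)) (t b)
      rw [Matrix.mul_diagonal, Matrix.mul_apply] at this
      simp only [Matrix.of_apply, Finset.sum_apply, Pi.smul_apply, smul_eq_mul]
      exact this.symm
    rw [e, det_updateRow_expand g s t a (R (s a))]
  simp only [h2]
  rw [sum_updateRow_eq, Finset.mul_sum]
  refine Finset.sum_congr rfl fun b _ => ?_
  have : (fun a => (Matrix.of fun a b => g (s a) (t b) * lam (t b) : Matrix (Fin k) (Fin k) ℝ) a b)
      = lam (t b) • (fun a => (g.submatrix s t) a b) := by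
    funext a
    simp [mul_comm]
  rw [this, Matrix.det_updateCol_smul, Matrix.updateCol_eq_self, mul_comm]
  rfl

theorem castLE_le {k n : ℕ} (h : k ≤ n) (t : Fin k ↪o Fin n) :
    ∀ (m : ℕ) (hm : m < k), m ≤ t ⟨m, hm⟩ := by
  intro m
  induction m with
  | zero => intro _; exact Nat.zero_le _
  | succ m ih =>
    intro hm
    have h1 := ih (by omega)
    have h2 : t ⟨m, by omega⟩ < t ⟨m + 1, hm⟩ := t.strictMono (by simp [Fin.lt_def])
    rw [Fin.lt_def] at h2
    omega

theorem sum_lt_top {k n : ℕ} (h : k ≤ n) (lam : Fin n → ℝ) (hl : StrictAnti lam)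
    (t : Fin k ↪o Fin n) (ht : t ≠ Fin.castLEOrderEmb h) :
    ∑ b, lam (t b) < ∑ b, lam (Fin.castLEOrderEmb h b) := by
  have hle : ∀ b, Fin.castLEOrderEmb h b ≤ t b := fun b => castLE_le h t b b.2
  apply Finset.sum_lt_sum (fun b _ => hl.antitone (hle b))
  by_contra hcon
  push Not at hcon
  apply ht
  apply DFunLike.ext
  intro b
  rcases (hle b).lt_or_eq with h' | h'
  · have := hcon b (Finset.mem_univ _)
    have := hl h'
    linarith
  · exact h'.symm

/-- Connectivity of `k`-subsets under adjacent moves. -/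
theorem connected_subsets {k n : ℕ} (h : k ≤ n) (Z : (Fin k ↪o Fin n) → Prop)
    (hZ : ∀ (s s' : Fin k ↪o Fin n) (a : Fin k) (l : Fin n),
      (s' : Fin k → Fin n) = Function.update s a l →
      ((l : ℕ) = s a + 1 ∨ (s a : ℕ) = l + 1) → Z s → Z s') (s0 : Fin k ↪o Fin n) (h0 : Z s0)
    (s : Fin k ↪o Fin n) : Z s := by
  have key : ∀ (N : ℕ) (s : Fin k ↪o Fin n), ∑ a, (s a : ℕ) = N →
      (Z s ↔ Z (Fin.castLEOrderEmb h)) := by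
    intro N
    induction N using Nat.strong_induction_on with
    | _ N ih =>
      intro s hs
      by_cases hst : s = Fin.castLEOrderEmb h
      · rw [hst]
      · have hex : ∃ m, ∃ hm : m < k, (s ⟨m, hm⟩ : ℕ) ≠ m := by
          by_contra hcon
          push Not at hcon
          apply hst
          apply DFunLike.ext
          intro b
          exact Fin.ext (hcon b b.2)
        classical
        obtain ⟨m, ⟨hm, hne⟩, hmin'⟩ : ∃ m, (∃ hm : m < k, (s ⟨m, hm⟩ : ℕ) ≠ m) ∧
            ∀ c, c < m → ¬ ∃ hm : c < k, (s ⟨c, hm⟩ : ℕ) ≠ c :=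
          ⟨Nat.find hex, Nat.find_spec hex, fun c hc => Nat.find_min hex hc⟩
        have hmin : ∀ c, c < m → ∀ hc : c < k, (s ⟨c, hc⟩ : ℕ) = c := by
          intro c hc hck
          have := hmin' c hc
          push Not at this
          exact this hck
        have hle := castLE_le h s m hm
        set a : Fin k := ⟨m, hm⟩ with ha
        let l : Fin n := ⟨(s a : ℕ) - 1, by have := (s a).2; omega⟩
        have hl : (s a : ℕ) = l + 1 := by simp only [l]; omega
        have hr : ∀ c, s c ≠ l := by
          intro c hc
          have hc' : (s c : ℕ) = s a - 1 := by rw [hc]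
          have : s c < s a := by rw [Fin.lt_def]; omega
          have hca : c < a := s.strictMono.lt_iff_lt.1 this
          have := hmin c hca c.2
          have hcm : (c : ℕ) < m := hca
          simp only [Fin.eta] at this
          omega
        have hsm := update_adj s a l (Or.inr hl) hr
        set s' : Fin k ↪o Fin n := OrderEmbedding.ofStrictMono _ hsm with hs'
        have hs'c : (s' : Fin k → Fin n) = Function.update s a l := rfl
        have hlt : ∑ a, (s' a : ℕ) < N := by
          rw [← hs]
          apply Finset.sum_lt_sum
          · intro c _
            rw [hs'c]
            by_cases hc : c = a
            · rw [hc, Function.update_self]; omega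
            · rw [Function.update_of_ne hc]
          · refine ⟨a, Finset.mem_univ _, ?_⟩
            rw [hs'c, Function.update_self]; omega
        rw [← ih _ hlt s' rfl]
        constructor
        · exact hZ s s' a l hs'c (Or.inr hl)
        · refine hZ s' s a (s a) ?_ ?_
          · rw [hs'c]; simp
          · left
            rw [hs'c, Function.update_self]; omega
  rw [key _ s rfl, ← key _ s0 rfl]
  exact h0

theorem jac_minors {n k : ℕ} (hk : k ≤ n) {R : Matrix (Fin n) (Fin n) ℝ} (h : IsJac R)
    (g : Matrix (Fin n) (Fin n) ℝ) (lam : Fin n → ℝ) (hl : StrictAnti lam)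
    (hR : R * g = g * Matrix.diagonal lam) (hg : g * gᵀ = 1) :
    (∀ s : Fin k ↪o Fin n, 0 < (g.submatrix s (Fin.castLE hk)).det) ∨
    (∀ s : Fin k ↪o Fin n, (g.submatrix s (Fin.castLE hk)).det < 0) := by
  classical
  set t0 : Fin k ↪o Fin n := Fin.castLEOrderEmb hk with ht0
  have hD := derivMat_mul (k := k) h g lam hR
  have hT := compoundMat_orth (k := k) g hg
  have hsign := perron_sign (derivMat k R) (compoundMat k g) _ t0 hT hD
    (fun t ht => sum_lt_top hk lam hl t ht) (fun s t hst => derivMat_nonneg h s t hst)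
  have hT' : (compoundMat k g)ᵀ * compoundMat k g = 1 := mul_eq_one_comm.1 hT
  -- no zeros
  have hsub : ∀ e : ℝ, (e = 1 ∨ e = -1) → (∀ s, 0 ≤ e * compoundMat k g s t0) →
      ∀ s, e * compoundMat k g s t0 ≠ 0 := by
    intro e he hpos s0 h0
    have hall : ∀ s, e * compoundMat k g s t0 = 0 := by
      intro s
      refine connected_subsets hk (fun s => e * compoundMat k g s t0 = 0) ?_ s0 h0 s
      intro s s' a l hs' hadj hs
      have heq := congrFun (congrFun hD s) t0
      rw [Matrix.mul_diagonal, Matrix.mul_apply] at heq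
      have hsum : ∑ r, derivMat k R s r * (e * compoundMat k g r t0) = 0 := by
        calc _ = e * ∑ r, derivMat k R s r * compoundMat k g r t0 := by
              rw [Finset.mul_sum]
              exact Finset.sum_congr rfl fun r _ => by ring
          _ = 0 := by rw [heq, ← mul_assoc, hs, zero_mul]
      have hnn : ∀ r ∈ Finset.univ, 0 ≤ derivMat k R s r * (e * compoundMat k g r t0) := by
        intro r _
        by_cases hr : s = r
        · rw [← hr, hs, mul_zero]
        · exact mul_nonneg (derivMat_nonneg h s r hr) (hpos r)
      have := (Finset.sum_eq_zero_iff_of_nonneg hnn).1 hsum s' (Finset.mem_univ _)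
      exact (mul_eq_zero.1 this).resolve_left (derivMat_pos h s s' a l hs' hadj).ne'
    have h1 := congrFun (congrFun hT' t0) t0
    rw [Matrix.mul_apply, Matrix.one_apply_eq] at h1
    have h2 : ∀ s, compoundMat k g s t0 = 0 := by
      intro s
      have := hall s
      rcases he with rfl | rfl
      · simpa using this
      · simpa using this
    simp [h2] at h1
  rcases hsign with hs | hs
  · left
    intro s
    have := hsub 1 (Or.inl rfl) (by simpa using hs) s
    rw [one_mul] at this
    exact lt_of_le_of_ne (hs s) this.symm
  · right
    intro s
    have := hsub (-1) (Or.inr rfl) (by simpa using hs) s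
    have h2 : compoundMat k g s t0 ≠ 0 := by simpa using this
    exact lt_of_le_of_ne (hs s) h2

theorem jac_eigvec_zero {n : ℕ} {R : Matrix (Fin n) (Fin n) ℝ} (h : IsJac R) (w : Fin n → ℝ)
    (c : ℝ) (hw : R *ᵥ w = c • w) (h0 : ∀ i : Fin n, (i : ℕ) = 0 → w i = 0) : w = 0 := by
  have key : ∀ (m : ℕ) (i : Fin n), (i : ℕ) ≤ m → w i = 0 := by
    intro m
    induction m with
    | zero => intro i hi; exact h0 i (by omega)
    | succ m ih =>
      intro i hi
      rcases Nat.lt_or_ge (i : ℕ) (m + 1) with h' | h'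
      · exact ih i (by omega)
      · have him : (i : ℕ) = m + 1 := by omega
        have hmn : m < n := by omega
        have h1 := congrFun hw ⟨m, hmn⟩
        rw [Matrix.mulVec, dotProduct, Finset.sum_eq_single i, Pi.smul_apply,
          ih ⟨m, hmn⟩ le_rfl, smul_zero] at h1
        · exact (mul_eq_zero.1 h1).resolve_left (h.pos _ _ him).ne'
        · intro j _ hj
          rcases Nat.lt_or_ge m (j : ℕ) with hj' | hj'
          · rw [h.tri, zero_mul]
            have : (j : ℕ) ≠ i := fun h => hj (Fin.ext h)
            simp only
            omega
          · rw [ih j hj', mul_zero]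
        · simp
  funext i
  exact key i i le_rfl

theorem jac_simple {n : ℕ} {R : Matrix (Fin n) (Fin n) ℝ} (h : IsJac R)
    (g : Matrix (Fin n) (Fin n) ℝ) (lam : Fin n → ℝ) (hl : Antitone lam)
    (hR : R * g = g * Matrix.diagonal lam) (hg : gᵀ * g = 1) : StrictAnti lam := by
  refine hl.strictAnti_of_injective ?_
  intro a b hab
  by_contra hne
  have hcol : ∀ c, R *ᵥ (fun i => g i c) = lam c • fun i => g i c := by
    intro c
    funext i
    have := congrFun (congrFun hR i) c
    rw [Matrix.mul_diagonal, Matrix.mul_apply] at this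
    simp only [Matrix.mulVec, dotProduct, Pi.smul_apply, smul_eq_mul]
    rw [this, mul_comm]
  have hn : 0 < n := a.pos
  have hcz : ∀ c, g ⟨0, hn⟩ c ≠ 0 := by
    intro c hc
    have := jac_eigvec_zero h _ _ (hcol c) (fun i hi => by
      rw [show i = ⟨0, hn⟩ from Fin.ext hi]; exact hc)
    have h1 := congrFun (congrFun hg c) c
    rw [Matrix.mul_apply, Matrix.one_apply_eq] at h1
    have h2 : ∀ i, g i c = 0 := fun i => congrFun this i
    simp [h2] at h1
  have hw := jac_eigvec_zero h (g ⟨0, hn⟩ b • (fun i => g i a) - g ⟨0, hn⟩ a • (fun i => g i b))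
    (lam a) (by
      rw [Matrix.mulVec_sub, Matrix.mulVec_smul, Matrix.mulVec_smul, hcol, hcol, ← hab, smul_sub,
        smul_comm (lam a), smul_comm (lam a)])
    (fun i hi => by
      rw [show i = ⟨0, hn⟩ from Fin.ext hi]
      simp [mul_comm])
  have h1 := congrFun (congrFun hg a) a
  have h2 := congrFun (congrFun hg a) b
  rw [Matrix.mul_apply, Matrix.one_apply_eq] at h1
  rw [Matrix.mul_apply, Matrix.one_apply_ne hne] at h2
  have h3 : ∑ i, g i a * (g ⟨0, hn⟩ b * g i a - g ⟨0, hn⟩ a * g i b) = 0 := by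
    apply Finset.sum_eq_zero
    intro i _
    have := congrFun hw i
    simp only [Pi.sub_apply, Pi.smul_apply, smul_eq_mul, Pi.zero_apply] at this
    rw [this, mul_zero]
  have h4 : ∑ i, g i a * (g ⟨0, hn⟩ b * g i a - g ⟨0, hn⟩ a * g i b) =
      g ⟨0, hn⟩ b * ∑ i, gᵀ a i * g i a - g ⟨0, hn⟩ a * ∑ i, gᵀ a i * g i b := by
    rw [Finset.mul_sum, Finset.mul_sum, ← Finset.sum_sub_distrib]
    exact Finset.sum_congr rfl fun i _ => by simp only [Matrix.transpose_apply]; ring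
  rw [h3, h1, h2] at h4
  exact hcz b (by linarith)

theorem real_spectral {n : ℕ} (R : Matrix (Fin n) (Fin n) ℝ) (hs : Rᵀ = R) :
    ∃ (g : Matrix (Fin n) (Fin n) ℝ) (lam : Fin n → ℝ), g * gᵀ = 1 ∧ gᵀ * g = 1 ∧ Antitone lam ∧
      R * g = g * Matrix.diagonal lam := by
  have hH : R.IsHermitian := by
    rw [Matrix.IsHermitian, Matrix.conjTranspose_eq_transpose_of_trivial, hs]
  set U : Matrix (Fin n) (Fin n) ℝ := hH.eigenvectorUnitary.1 with hU
  have hUU : Uᵀ * U = 1 := by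
    have := Unitary.coe_star_mul_self hH.eigenvectorUnitary
    rw [Matrix.star_eq_conjTranspose, Matrix.conjTranspose_eq_transpose_of_trivial] at this
    exact this
  have hRU : R * U = U * Matrix.diagonal hH.eigenvalues := by
    have h1 := hH.spectral_theorem
    rw [Unitary.conjStarAlgAut_apply, Matrix.star_eq_conjTranspose,
      Matrix.conjTranspose_eq_transpose_of_trivial] at h1
    have h2 : R = U * Matrix.diagonal hH.eigenvalues * Uᵀ := h1
    calc R * U = U * Matrix.diagonal hH.eigenvalues * Uᵀ * U := by rw [← h2]
      _ = _ := by rw [Matrix.mul_assoc, hUU, Matrix.mul_one]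
  set d := hH.eigenvalues
  set σ := Tuple.sort (fun i => - d i) with hσ
  have hg : (U.submatrix id σ)ᵀ * (U.submatrix id σ) = 1 := by
    have : (Uᵀ * U).submatrix σ σ = 1 := by
      rw [hUU]; exact Matrix.submatrix_one _ σ.injective
    rw [← this]
    ext a b
    simp [Matrix.mul_apply]
  refine ⟨U.submatrix id σ, d ∘ σ, mul_eq_one_comm.1 hg, hg, ?_, ?_⟩
  · intro a b hab
    have := Tuple.monotone_sort (fun i => - d i) hab
    simp only [Function.comp_apply, neg_le_neg_iff] at this
    exact this
  · ext i a
    have := congrFun (congrFun hRU i) (σ a)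
    rw [Matrix.mul_diagonal, Matrix.mul_apply] at this
    rw [Matrix.mul_diagonal, Matrix.mul_apply]
    exact this

/-- Main real theorem: Jacobi matrices have totally positive eigenvector matrices. -/
theorem jac_core {n : ℕ} {R : Matrix (Fin n) (Fin n) ℝ} (h : IsJac R) :
    ∃ (g : Matrix (Fin n) (Fin n) ℝ) (lam : Fin n → ℝ), g * gᵀ = 1 ∧ StrictAnti lam ∧
      R = g * Matrix.diagonal lam * gᵀ ∧
      ∀ (k : ℕ) (hk : k ≤ n) (s : Fin k ↪o Fin n), 0 < (g.submatrix s (Fin.castLE hk)).det := by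
  obtain ⟨g, lam, hg, hg', hl, hR⟩ := real_spectral R h.symm
  have hl := jac_simple h g lam hl hR hg'
  have hσ : ∀ k : ℕ, ∃ e : ℝ, e * e = 1 ∧ ∀ (hk : k ≤ n) (s : Fin k ↪o Fin n),
      0 < e * (g.submatrix s (Fin.castLE hk)).det := by
    intro k
    by_cases hk : k ≤ n
    · rcases jac_minors hk h g lam hl hR hg with h1 | h1
      · exact ⟨1, by norm_num, fun _ s => by rw [one_mul]; exact h1 s⟩
      · exact ⟨-1, by norm_num, fun _ s => by have := h1 s; linarith⟩
    · exact ⟨1, by norm_num, fun hk' => absurd hk' hk⟩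
  choose e he hpos using hσ
  have he0 : e 0 = 1 := by
    have := hpos 0 (Nat.zero_le _) (Fin.castLEOrderEmb (Nat.zero_le n))
    rw [Matrix.det_fin_zero, mul_one] at this
    have := he 0
    nlinarith
  let ε : ℕ → ℝ := fun m => e m * e (m + 1)
  have hprod : ∀ k, ∏ m ∈ range k, ε m = e k := by
    intro k
    induction k with
    | zero => simp [he0]
    | succ k ih =>
      rw [Finset.prod_range_succ, ih]
      simp only [ε]
      rw [← mul_assoc, he, one_mul]
  have hεε : ∀ m, ε m * ε m = 1 := fun m => by
    simp only [ε]
    linear_combination (e (m + 1) * e (m + 1)) * he m + he (m + 1)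
  set E : Matrix (Fin n) (Fin n) ℝ := Matrix.diagonal (fun m : Fin n => ε m) with hE
  have hEE : E * E = 1 := by
    rw [hE, Matrix.diagonal_mul_diagonal]
    simp only [hεε]
    exact Matrix.diagonal_one
  have hET : Eᵀ = E := Matrix.diagonal_transpose _
  refine ⟨g * E, lam, ?_, hl, ?_, ?_⟩
  · rw [Matrix.transpose_mul, hET, Matrix.mul_assoc, ← Matrix.mul_assoc E, hEE, Matrix.one_mul, hg]
  · have hcomm : E * Matrix.diagonal lam = Matrix.diagonal lam * E := by
      rw [hE, Matrix.diagonal_mul_diagonal, Matrix.diagonal_mul_diagonal]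
      congr 1
      funext i
      ring
    have : g * E * Matrix.diagonal lam * (g * E)ᵀ = g * Matrix.diagonal lam * gᵀ := by
      rw [Matrix.transpose_mul, hET, Matrix.mul_assoc g E, hcomm]
      simp only [Matrix.mul_assoc]
      rw [← Matrix.mul_assoc E E, hEE, Matrix.one_mul]
    rw [this, ← hR, Matrix.mul_assoc, hg, Matrix.mul_one]
  · intro k hk s
    have h1 : (g * E).submatrix s (Fin.castLE hk) =
        (g.submatrix s (Fin.castLE hk)) * Matrix.diagonal (fun b : Fin k => ε b) := by
      ext a b
      rw [Matrix.mul_diagonal, Matrix.submatrix_apply, hE, Matrix.mul_diagonal]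
      rfl
    rw [h1, Matrix.det_mul, Matrix.det_diagonal, Fin.prod_univ_eq_prod_range ε, hprod, mul_comm]
    exact hpos k hk s

theorem antitone_unique {n : ℕ} (f g : Fin n → ℝ) (hf : Antitone f) (hg : Antitone g)
    (u v : Matrix (Fin n) (Fin n) ℂ) (hu : uᴴ * u = 1) (hv : vᴴ * v = 1)
    (h : u * Matrix.diagonal (fun i => (f i : ℂ)) * uᴴ =
      v * Matrix.diagonal (fun i => (g i : ℂ)) * vᴴ) : f = g := by
  have key : ∀ (u : Matrix (Fin n) (Fin n) ℂ) (f : Fin n → ℝ), uᴴ * u = 1 →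
      (u * Matrix.diagonal (fun i => (f i : ℂ)) * uᴴ).charpoly.roots =
        (Finset.univ.val.map f).map (fun x : ℝ => (x : ℂ)) := by
    intro u f hu
    rw [Matrix.charpoly_mul_comm, ← Matrix.mul_assoc, hu, Matrix.one_mul, Matrix.charpoly_diagonal,
      Polynomial.roots_prod _ _ (Finset.prod_ne_zero_iff.2 fun i _ => Polynomial.X_sub_C_ne_zero _),
      Multiset.map_map]
    simp only [Polynomial.roots_X_sub_C, Multiset.bind_singleton]
    rfl
  have h1 := key u f hu
  rw [h, key v g hv] at h1
  have h2 := Multiset.map_injective Complex.ofReal_injective h1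
  rw [Fin.univ_val_map, Fin.univ_val_map, Multiset.coe_eq_coe] at h2
  have h3 := List.Perm.eq_of_sortedGE hg.sortedGE_ofFn hf.sortedGE_ofFn h2
  exact (List.ofFn_injective h3).symm

theorem complex_core {n : ℕ} (L : Matrix (Fin n) (Fin n) ℂ)
    (htri : ∀ i j : Fin n, ((i : ℕ) + 2 ≤ (j : ℕ) ∨ (j : ℕ) + 2 ≤ (i : ℕ)) → L i j = 0)
    (him : ∀ i j : Fin n, (L i j).im = 0) (hsym : ∀ i j : Fin n, L j i = L i j)
    (hpos : ∀ i j : Fin n, (j : ℕ) = (i : ℕ) + 1 → 0 < (L i j).re) :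
    ∃ g ∈ UnitaryTP n, ∃ lam : Fin n → ℝ, StrictAnti lam ∧
      L = g * Matrix.diagonal (fun i => (lam i : ℂ)) * gᴴ := by
  let R : Matrix (Fin n) (Fin n) ℝ := fun i j => (L i j).re
  have hJ : IsJac R := by
    refine ⟨?_, ?_, hpos⟩
    · ext i j
      change (L j i).re = (L i j).re
      rw [hsym]
    · intro i j hij
      simp only [R, htri i j hij, Complex.zero_re]
  obtain ⟨g, lam, hg, hl, hR, hm⟩ := jac_core hJ
  have hstar : (g.map Complex.ofRealHom)ᴴ = gᵀ.map Complex.ofRealHom := by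
    ext i j
    simp
  have hdiag : Matrix.diagonal (fun i => (lam i : ℂ)) =
      (Matrix.diagonal lam).map Complex.ofRealHom := by
    rw [Matrix.diagonal_map (by simp)]
    rfl
  have hone : (1 : Matrix (Fin n) (Fin n) ℝ).map Complex.ofRealHom = 1 :=
    Matrix.map_one _ (by simp) (by simp)
  refine ⟨g.map Complex.ofRealHom, ⟨?_, ?_⟩, lam, hl, ?_⟩
  · rw [hstar, ← Matrix.map_mul, mul_eq_one_comm.1 hg, hone]
  · intro I
    have hI : I.card ≤ n := by simpa using I.card_le_univ
    rw [leftMinor_eq _ I hI, isPosReal_iff]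
    have : ((g.map Complex.ofRealHom).submatrix (I.orderEmbOfFin rfl) (Fin.castLE hI)).det
        = Complex.ofRealHom (g.submatrix (I.orderEmbOfFin rfl) (Fin.castLE hI)).det := by
      rw [RingHom.map_det]
      rfl
    rw [this]
    exact Complex.zero_lt_real.2 (hm _ hI _)
  · rw [hstar, hdiag, ← Matrix.map_mul, ← Matrix.map_mul, ← hR]
    ext i j
    apply Complex.ext
    · exact (Complex.ofReal_re (L i j).re).symm
    · exact (him i j).trans (Complex.ofReal_im (L i j).re).symm

theorem isCompact_unitary (n : ℕ) :
    IsCompact {g : Matrix (Fin n) (Fin n) ℂ | gᴴ * g = 1} := by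
  have hK : IsCompact (Set.univ.pi fun _ : Fin n => Set.univ.pi fun _ : Fin n =>
      Metric.closedBall (0 : ℂ) 1) :=
    isCompact_univ_pi fun _ => isCompact_univ_pi fun _ => isCompact_closedBall _ _
  refine hK.of_isClosed_subset (t := {g : Matrix (Fin n) (Fin n) ℂ | gᴴ * g = 1}) ?_ ?_
  · have : Continuous fun g : Matrix (Fin n) (Fin n) ℂ => gᴴ * g :=
      (continuous_id.matrix_conjTranspose).matrix_mul continuous_id
    exact isClosed_eq this continuous_const
  · intro g hg i _ j _
    rw [mem_closedBall_zero_iff]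
    exact entry_norm_bound_of_unitary (Matrix.mem_unitaryGroup_iff'.2 hg) i j

theorem closure_core {n : ℕ} (lam : Fin n → ℝ) (hanti : Antitone lam)
    (L : Matrix (Fin n) (Fin n) ℂ)
    (htri : ∀ i j : Fin n, ((i : ℕ) + 2 ≤ (j : ℕ) ∨ (j : ℕ) + 2 ≤ (i : ℕ)) → L i j = 0)
    (hEig : ∃ u : Matrix (Fin n) (Fin n) ℂ, u.conjTranspose * u = 1 ∧
      L = u * Matrix.diagonal (fun i => (lam i : ℂ)) * u.conjTranspose)
    (him : ∀ i j : Fin n, (L i j).im = 0) (hsym : ∀ i j : Fin n, L j i = L i j)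
    (hpos : ∀ i j : Fin n, (j : ℕ) = (i : ℕ) + 1 → 0 ≤ (L i j).re) :
    L ∈ OrbitTNN lam := by
  classical
  let J : Matrix (Fin n) (Fin n) ℂ := fun i j =>
    if (j : ℕ) = i + 1 ∨ (i : ℕ) = j + 1 then 1 else 0
  let δ : ℕ → ℝ := fun m => 1 / ((m : ℝ) + 1)
  have hδ : ∀ m, 0 < δ m := fun m => Nat.one_div_pos_of_nat
  let M : ℕ → Matrix (Fin n) (Fin n) ℂ := fun m => L + (δ m : ℂ) • J
  have hM : ∀ m, ∃ g ∈ UnitaryTP n, ∃ lam : Fin n → ℝ, StrictAnti lam ∧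
      M m = g * Matrix.diagonal (fun i => (lam i : ℂ)) * gᴴ := by
    intro m
    have hMe : ∀ i j, M m i j = L i j +
        (δ m : ℂ) * (if (j : ℕ) = i + 1 ∨ (i : ℕ) = j + 1 then 1 else 0) := fun i j => rfl
    apply complex_core
    · intro i j hij
      rw [hMe, htri i j hij, if_neg (by omega)]
      simp
    · intro i j
      rw [hMe]
      split_ifs <;> simp [him]
    · intro i j
      rw [hMe, hMe, hsym i j]
      simp only [or_comm]
    · intro i j hij
      rw [hMe, if_pos (Or.inl hij)]
      have := hpos i j hij
      have := hδ m
      simp only [mul_one, Complex.add_re, Complex.ofReal_re]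
      linarith
  choose g hg mu hmu hMg using hM
  have hMlim : Filter.Tendsto M Filter.atTop (nhds L) := by
    have h1 : Filter.Tendsto δ Filter.atTop (nhds 0) := tendsto_one_div_add_atTop_nhds_zero_nat
    have h2 : Filter.Tendsto (fun m => (δ m : ℂ)) Filter.atTop (nhds 0) := by
      have := (Complex.continuous_ofReal.tendsto 0).comp h1
      rw [Complex.ofReal_zero] at this
      exact this
    have h3 := (h2.smul_const J).const_add L
    rw [zero_smul, add_zero] at h3
    exact h3
  have : FirstCountableTopology (Matrix (Fin n) (Fin n) ℂ) :=
    inferInstanceAs (FirstCountableTopology (Fin n → Fin n → ℂ))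
  obtain ⟨G, hG, φ, hφ, hlim⟩ := (isCompact_unitary n).tendsto_subseq (fun m => (hg m).1)
  have hMφ := hMlim.comp hφ.tendsto_atTop
  have hGG : G * Gᴴ = 1 := mul_eq_one_comm.1 hG
  have hconj : Filter.Tendsto (fun m => (g (φ m))ᴴ) Filter.atTop (nhds Gᴴ) :=
    ((continuous_id.matrix_conjTranspose).tendsto G).comp hlim
  have hD : ∀ m, (g m)ᴴ * M m * g m = Matrix.diagonal (fun i => (mu m i : ℂ)) := by
    intro m
    have h1 : (g m)ᴴ * g m = 1 := (hg m).1
    rw [hMg m]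
    simp only [Matrix.mul_assoc]
    rw [h1, Matrix.mul_one, ← Matrix.mul_assoc, h1, Matrix.one_mul]
  have hDlim : Filter.Tendsto (fun m => Matrix.diagonal (fun i => (mu (φ m) i : ℂ))) Filter.atTop
      (nhds (Gᴴ * L * G)) := by
    have := (hconj.mul hMφ).mul hlim
    refine this.congr fun m => ?_
    exact hD (φ m)
  have hDent : ∀ i j, Filter.Tendsto (fun m => Matrix.diagonal (fun i => (mu (φ m) i : ℂ)) i j)
      Filter.atTop (nhds ((Gᴴ * L * G) i j)) := by
    intro i j
    exact ((continuous_apply_apply i j).tendsto (Gᴴ * L * G)).comp hDlim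
  have hre : ∀ i, Filter.Tendsto (fun m => mu (φ m) i) Filter.atTop
      (nhds ((Gᴴ * L * G) i i).re) := by
    intro i
    have := (Complex.continuous_re.tendsto _).comp (hDent i i)
    refine this.congr fun m => ?_
    simp
  let nu : Fin n → ℝ := fun i => ((Gᴴ * L * G) i i).re
  have hnu : Antitone nu := by
    intro a b hab
    exact le_of_tendsto_of_tendsto' (hre b) (hre a) fun m => (hmu (φ m)).antitone hab
  have hGL : Gᴴ * L * G = Matrix.diagonal (fun i => (nu i : ℂ)) := by
    ext i j
    by_cases hij : i = j
    · subst hij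
      rw [Matrix.diagonal_apply_eq]
      refine tendsto_nhds_unique (hDent i i) ?_
      simp only [Matrix.diagonal_apply_eq]
      exact (Complex.continuous_ofReal.tendsto _).comp (hre i)
    · rw [Matrix.diagonal_apply_ne _ hij]
      refine tendsto_nhds_unique (hDent i j) ?_
      simp only [Matrix.diagonal_apply_ne _ hij]
      exact tendsto_const_nhds
  have hLG : L = G * Matrix.diagonal (fun i => (nu i : ℂ)) * Gᴴ := by
    rw [← hGL]
    simp only [Matrix.mul_assoc]
    rw [hGG, Matrix.mul_one, ← Matrix.mul_assoc, hGG, Matrix.one_mul]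
  obtain ⟨u, hu, hLu⟩ := hEig
  have hnl : nu = lam := antitone_unique nu lam hnu hanti G u hG hu (by rw [← hLG, ← hLu])
  rw [hnl] at hLG
  have hfin : Filter.Tendsto (fun m => g (φ m) * Matrix.diagonal (fun i => (lam i : ℂ)) *
      (g (φ m))ᴴ) Filter.atTop (nhds L) := by
    rw [hLG]
    exact (hlim.mul tendsto_const_nhds).mul hconj
  exact mem_closure_of_tendsto hfin (Filter.Eventually.of_forall fun m => ⟨g (φ m), hg _, rfl⟩)

/-- A tridiagonal Hermitian matrix is real symmetric when its superdiagonal is real. -/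
theorem real_of_super {n : ℕ} (L : Matrix (Fin n) (Fin n) ℂ) (hH : Lᴴ = L)
    (htri : ∀ i j : Fin n, ((i : ℕ) + 2 ≤ (j : ℕ) ∨ (j : ℕ) + 2 ≤ (i : ℕ)) → L i j = 0)
    (hs : ∀ i j : Fin n, (j : ℕ) = i + 1 → (L i j).im = 0) :
    (∀ i j : Fin n, (L i j).im = 0) ∧ (∀ i j : Fin n, L j i = L i j) := by
  have hst : ∀ i j, star (L i j) = L j i := fun i j => by
    have := congrFun (congrFun hH j) i
    rwa [Matrix.conjTranspose_apply] at this
  have hneg : ∀ i j, (L j i).im = - (L i j).im := fun i j => by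
    rw [← hst i j]; simp
  have him : ∀ i j : Fin n, (L i j).im = 0 := by
    intro i j
    by_cases h1 : (j : ℕ) = i + 1
    · exact hs i j h1
    · by_cases h2 : (i : ℕ) = j + 1
      · rw [hneg j i, hs j i h2, neg_zero]
      · by_cases h3 : i = j
        · subst h3
          have := hneg i i
          linarith
        · have : (i : ℕ) ≠ j := fun h => h3 (Fin.ext h)
          rw [htri i j (by omega), Complex.zero_im]
  refine ⟨him, fun i j => ?_⟩
  rw [← hst i j]
  exact Complex.conj_eq_iff_im.2 (him i j)

end Helpers

/-- Let `λ` be weakly decreasing and nonconstant and let `L` be a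
tridiagonal Hermitian matrix with eigenvalue multiset `{λ₁,…,λₙ}`. Then:
(a) `L ∈ O_λ^{>0}` iff `L` is real symmetric with positive superdiagonal entries;
moreover if `L ∈ O_λ^{>0}` then `λ` is strictly decreasing (so if `λ` is not strictly
decreasing then `O_λ^{>0}` contains no tridiagonal matrix);
(b) `L ∈ O_λ^{≥0}` iff `L` is real symmetric with nonnegative superdiagonal entries. -/
theorem tridiagonal_orbit_characterization {n : ℕ} (lam : Fin n → ℝ)
    (hanti : Antitone lam) (hnc : ∃ a b : Fin n, lam a ≠ lam b)
    (L : Matrix (Fin n) (Fin n) ℂ)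
    (htri : ∀ i j : Fin n, ((i : ℕ) + 2 ≤ (j : ℕ) ∨ (j : ℕ) + 2 ≤ (i : ℕ)) → L i j = 0)
    (hEig : ∃ u : Matrix (Fin n) (Fin n) ℂ, u.conjTranspose * u = 1 ∧
      L = u * Matrix.diagonal (fun i => (lam i : ℂ)) * u.conjTranspose) :
    ((L ∈ OrbitTP lam) ↔
      ((∀ i j : Fin n, (L i j).im = 0) ∧ (∀ i j : Fin n, L j i = L i j) ∧
        ∀ i j : Fin n, (j : ℕ) = (i : ℕ) + 1 → 0 < (L i j).re)) ∧
    (L ∈ OrbitTP lam → StrictAnti lam) ∧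
    ((L ∈ OrbitTNN lam) ↔
      ((∀ i j : Fin n, (L i j).im = 0) ∧ (∀ i j : Fin n, L j i = L i j) ∧
        ∀ i j : Fin n, (j : ℕ) = (i : ℕ) + 1 → 0 ≤ (L i j).re)) := by
  have hH : Lᴴ = L := by
    obtain ⟨u, -, rfl⟩ := hEig
    rw [Matrix.conjTranspose_mul, Matrix.conjTranspose_mul, Matrix.conjTranspose_conjTranspose,
      Matrix.diagonal_conjTranspose, Matrix.mul_assoc]
    congr 3
    funext i
    simp
  have hfwd : L ∈ OrbitTP lam → ((∀ i j : Fin n, (L i j).im = 0) ∧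
      (∀ i j : Fin n, L j i = L i j) ∧
        ∀ i j : Fin n, (j : ℕ) = (i : ℕ) + 1 → 0 < (L i j).re) := by
    intro hL
    have hp : ∀ i j : Fin n, (j : ℕ) = (i : ℕ) + 1 → IsPosReal (L i j) := fun i j hij =>
      (isPosReal_iff _).2 (orbit_entry_pos lam hanti hnc L hL i j hij)
    obtain ⟨h1, h2⟩ := real_of_super L hH htri (fun i j hij => (hp i j hij).2)
    exact ⟨h1, h2, fun i j hij => (hp i j hij).1⟩
  have hcore : ((∀ i j : Fin n, (L i j).im = 0) ∧ (∀ i j : Fin n, L j i = L i j) ∧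
        ∀ i j : Fin n, (j : ℕ) = (i : ℕ) + 1 → 0 < (L i j).re) →
        L ∈ OrbitTP lam ∧ StrictAnti lam := by
    rintro ⟨h1, h2, h3⟩
    obtain ⟨g, hg, mu, hmu, hLg⟩ := complex_core L htri h1 h2 h3
    obtain ⟨u, hu, hLu⟩ := hEig
    have hml : mu = lam := antitone_unique mu lam hmu.antitone hanti g u hg.1 hu
      (by rw [← hLg, ← hLu])
    rw [hml] at hLg hmu
    exact ⟨⟨g, hg, hLg⟩, hmu⟩
  refine ⟨⟨hfwd, fun h => (hcore h).1⟩, fun h => (hcore (hfwd h)).2, ?_, ?_⟩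
  · intro hL
    have hcl : ∀ i j : Fin n, (j : ℕ) = (i : ℕ) + 1 → IsNonnegReal (L i j) := by
      intro i j hij
      have hc : Continuous fun M : Matrix (Fin n) (Fin n) ℂ => M i j := continuous_apply_apply i j
      have hclosed : IsClosed {M : Matrix (Fin n) (Fin n) ℂ | 0 ≤ (M i j).re ∧ (M i j).im = 0} :=
        (isClosed_le continuous_const (Complex.continuous_re.comp hc)).inter
          (isClosed_eq (Complex.continuous_im.comp hc) continuous_const)
      refine closure_minimal (s := OrbitTP lam) ?_ hclosed hL
      intro M hM
      have := (isPosReal_iff _).2 (orbit_entry_pos lam hanti hnc M hM i j hij)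
      exact ⟨this.1.le, this.2⟩
    obtain ⟨h1, h2⟩ := real_of_super L hH htri (fun i j hij => (hcl i j hij).2)
    exact ⟨h1, h2, fun i j hij => (hcl i j hij).1⟩
  · rintro ⟨h1, h2, h3⟩
    exact closure_core lam hanti L htri hEig h1 h2 h3
end
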